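/- Let γ ∈ (−1, ∞) and ν ∈ (−2, ∞). Then there exist constants 0 < c ≤ C < ∞, depending only on γ, ν and κ, such that c · w_{γ,ν}(S(x, r)) ≤ w_{γ,ν}(B(x, r)) ≤ C · w_{γ,ν}(S(x, r)) for all x in the closure of 𝒟 and all r > 0. -/

import Mathlib

open MeasureTheory Set Real
open scoped ENNReal

noncomputable section

abbrev E2 := EuclideanSpace ℝ (Fin 2)

/-- The planar angular domain with opening angle `κ`. -/
def Dset (κ : ℝ) : Set E2 :=
  {x | ∃ r φ : ℝ, 0 < r ∧ 0 < φ ∧ φ < κ ∧ x 0 = r * Real.cos φ ∧ x 1 = r * Real.sin φ}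

/-- `B(x, r)`: the part of the Euclidean ball of radius `r` around `x` lying in `𝒟`. -/
def ballD (κ : ℝ) (x : E2) (r : ℝ) : Set E2 :=
  {y | y ∈ Dset κ ∧ dist y x < r}

/-- Geodesic (arc-length) distance between unit vectors of `S¹ ⊆ ℝ²`. -/
def dS1 (u v : E2) : ℝ := Real.arccos (inner ℝ u v)

/-- The "windshield wiper" set `S(x, r)`; for `x = 0` the angular condition is vacuous
(convention `a/0 = ∞`). -/
def Sset (κ : ℝ) (x : E2) (r : ℝ) : Set E2 :=
  {y | y ∈ Dset κ ∧ |‖y‖ - ‖x‖| < r ∧ (x ≠ 0 → dS1 (‖x‖⁻¹ • x) (‖y‖⁻¹ • y) < r / ‖x‖)}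

/-- Distance from `x` to the boundary of `𝒟`. -/
def rhoD (κ : ℝ) (x : E2) : ℝ := Metric.infDist x (frontier (Dset κ))

/-- The mixed power weight `w_{γ,ν}(x) = ρ_∘(x)^{ν-γ} ρ_𝒟(x)^γ`. -/
def wgt (κ γ ν : ℝ) (x : E2) : ℝ := ‖x‖ ^ (ν - γ) * rhoD κ x ^ γ

/-- `w_{γ,ν}(E) = ∫_E w_{γ,ν} dx`, valued in `[0,∞]`. -/
def wMeas (κ γ ν : ℝ) (E : Set E2) : ℝ≥0∞ :=
  ∫⁻ x in E, ENNReal.ofReal (wgt κ γ ν x)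

/-- The point of the plane with polar coordinates `p = (s, φ)`. -/
def polarPt (p : ℝ × ℝ) : E2 := !₂[p.1 * Real.cos p.2, p.1 * Real.sin p.2]

lemma dist_polarPt_sq (s t φ θ : ℝ) :
    dist (polarPt (s, φ)) (polarPt (t, θ)) ^ 2
      = (s - t) ^ 2 + 2 * s * t * (1 - Real.cos (φ - θ)) := by
  rw [EuclideanSpace.dist_eq, Real.sq_sqrt (by positivity), Real.cos_sub]
  simp only [polarPt, Fin.sum_univ_two, Real.dist_eq, sq_abs]
  simp only [Matrix.cons_val_zero, Matrix.cons_val_one]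
  linear_combination s ^ 2 * Real.sin_sq_add_cos_sq φ + t ^ 2 * Real.sin_sq_add_cos_sq θ

lemma inner_polarPt (s t φ θ : ℝ) :
    inner ℝ (polarPt (s, φ)) (polarPt (t, θ)) = s * t * Real.cos (φ - θ) := by
  simp only [polarPt, PiLp.inner_apply, Fin.sum_univ_two, RCLike.inner_apply, conj_trivial]
  simp only [Matrix.cons_val_zero, Matrix.cons_val_one]
  rw [Real.cos_sub]
  ring

lemma norm_polarPt {s : ℝ} (hs : 0 ≤ s) (φ : ℝ) : ‖polarPt (s, φ)‖ = s := by
  have h := inner_polarPt s s φ φ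
  rw [real_inner_self_eq_norm_sq, sub_self, Real.cos_zero, mul_one, ← sq] at h
  exact (sq_eq_sq₀ (norm_nonneg _) hs).1 h

lemma smul_polarPt (c s φ : ℝ) : c • polarPt (s, φ) = polarPt (c * s, φ) := by
  ext i
  fin_cases i <;> simp [polarPt, mul_assoc]

lemma dist_polarPt_le {s t : ℝ} (ht : 0 ≤ t) (φ θ : ℝ) :
    dist (polarPt (s, φ)) (polarPt (t, θ)) ≤ |s - t| + t * |φ - θ| := by
  refine (dist_triangle _ (polarPt (t, φ)) _).trans (add_le_add ?_ ?_)
  · refine abs_le_of_sq_le_sq' ?_ (abs_nonneg _) |>.2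
    rw [dist_polarPt_sq, sq_abs, sub_self, Real.cos_zero]
    simp
  · refine abs_le_of_sq_le_sq' ?_ (by positivity) |>.2
    rw [dist_polarPt_sq, mul_pow, sq_abs]
    nlinarith [Real.one_sub_sq_div_two_le_cos (x := φ - θ), sq_nonneg t]

lemma abs_sub_le_dist_polarPt {s t : ℝ} (hs : 0 ≤ s) (ht : 0 ≤ t) (φ θ : ℝ) :
    |s - t| ≤ dist (polarPt (s, φ)) (polarPt (t, θ)) := by
  have h := abs_norm_sub_norm_le (polarPt (s, φ)) (polarPt (t, θ))
  rwa [norm_polarPt hs, norm_polarPt ht, ← dist_eq_norm] at h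

/-- If the angles of two points are at least `m` apart on the circle, then so are the points,
up to the factor `s / π`. -/
lemma mul_le_pi_mul_dist_polarPt {s t φ θ m : ℝ} (hs : 0 ≤ s) (ht : 0 ≤ t) (hm : 0 ≤ m)
    (h1 : m ≤ |φ - θ|) (h2 : |φ - θ| ≤ 2 * π - m) :
    s * m ≤ π * dist (polarPt (s, φ)) (polarPt (t, θ)) := by
  have hmpi : m ≤ π := by linarith
  have hcos : Real.cos (φ - θ) ≤ Real.cos m := by
    rw [← Real.cos_abs (φ - θ)]
    rcases le_total |φ - θ| π with h | h
    · exact Real.cos_le_cos_of_nonneg_of_le_pi hm h h1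
    · rw [← Real.cos_two_pi_sub |φ - θ|]
      exact Real.cos_le_cos_of_nonneg_of_le_pi hm (by linarith) (by linarith)
  have hq := Real.cos_le_one_sub_mul_cos_sq (x := m) (by rwa [abs_of_nonneg hm])
  have hpi := Real.pi_pos
  have hq' : 2 * m ^ 2 ≤ π ^ 2 * (1 - Real.cos (φ - θ)) := by
    have : π ^ 2 * (2 / π ^ 2 * m ^ 2) = 2 * m ^ 2 := by field_simp
    nlinarith [sq_nonneg π]
  refine abs_le_of_sq_le_sq' ?_ (by positivity) |>.2
  rw [mul_pow π, dist_polarPt_sq]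
  have hst : 0 ≤ 2 * s * t := by positivity
  have hm2 : m ^ 2 ≤ π ^ 2 := by gcongr
  nlinarith [mul_le_mul_of_nonneg_left hq' hst, mul_le_mul_of_nonneg_right hm2 (sq_nonneg (s - t)),
    mul_nonneg hst (sq_nonneg m), mul_nonneg (sq_nonneg t) (sq_nonneg m)]

lemma exists_eq_polarPt (x : E2) :
    ∃ s φ : ℝ, 0 ≤ s ∧ 0 ≤ φ ∧ φ < 2 * π ∧ x = polarPt (s, φ) := by
  let z : ℂ := ⟨x 0, x 1⟩
  have h0 : ‖z‖ * Real.cos z.arg = x 0 := Complex.norm_mul_cos_arg z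
  have h1 : ‖z‖ * Real.sin z.arg = x 1 := Complex.norm_mul_sin_arg z
  have hpi := Real.pi_pos
  have hle := Complex.arg_le_pi z
  have hlt := Complex.neg_pi_lt_arg z
  rcases le_or_gt 0 z.arg with h | h
  · refine ⟨‖z‖, z.arg, norm_nonneg _, h, by linarith, ?_⟩
    ext i
    fin_cases i <;> simp [polarPt, h0, h1]
  · refine ⟨‖z‖, z.arg + 2 * π, norm_nonneg _, by linarith, by linarith, ?_⟩
    ext i
    fin_cases i <;> simp [polarPt, h0, h1]

lemma mem_Dset_iff {κ : ℝ} {x : E2} :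
    x ∈ Dset κ ↔ ∃ s φ : ℝ, 0 < s ∧ 0 < φ ∧ φ < κ ∧ x = polarPt (s, φ) := by
  constructor
  · rintro ⟨s, φ, hs, h0, h1, h2, h3⟩
    refine ⟨s, φ, hs, h0, h1, ?_⟩
    ext i
    fin_cases i <;> simp [polarPt, h2, h3]
  · rintro ⟨s, φ, hs, h0, h1, rfl⟩
    exact ⟨s, φ, hs, h0, h1, rfl, rfl⟩

lemma exists_of_mem_closure_Dset {κ : ℝ} {x : E2}
    (hx : x ∈ closure (Dset κ)) :
    ∃ s φ : ℝ, 0 ≤ s ∧ 0 ≤ φ ∧ φ ≤ κ ∧ x = polarPt (s, φ) := by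
  have hκ : 0 < κ := by
    obtain ⟨y, hy⟩ := closure_nonempty_iff.1 ⟨x, hx⟩
    obtain ⟨_, φ, _, h0, h1, _⟩ := hy
    exact h0.trans h1
  obtain ⟨s, φ, hs, hφ0, hφ1, rfl⟩ := exists_eq_polarPt x
  rcases hs.eq_or_lt with rfl | hs'
  · exact ⟨0, 0, le_rfl, le_rfl, hκ.le, by simp [polarPt]⟩
  refine ⟨s, φ, hs, hφ0, ?_, rfl⟩
  by_contra! hφ
  set m := min (φ - κ) (2 * π - φ) with hmdef
  have hm : 0 < m := lt_min (by linarith) (by linarith)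
  have hm1 : m ≤ φ - κ := min_le_left _ _
  have hm2 : m ≤ 2 * π - φ := min_le_right _ _
  obtain ⟨y, hy, hd⟩ := Metric.mem_closure_iff.1 hx (s * m / π) (by positivity)
  obtain ⟨t, θ, ht, h0, h1, rfl⟩ := mem_Dset_iff.1 hy
  have habs : |φ - θ| = φ - θ := abs_of_pos (by linarith)
  have := mul_le_pi_mul_dist_polarPt (φ := φ) (θ := θ) hs ht.le hm.le
    (by rw [habs]; linarith) (by rw [habs]; linarith)
  rw [lt_div_iff₀ Real.pi_pos] at hd
  linarith

/-- Angular distance to the boundary of the sector. -/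
def angDist (κ φ : ℝ) : ℝ := min φ (κ - φ)

lemma mul_angDist_le_of_notMem {κ s φ : ℝ} (hκ' : κ < 2 * π) (hs : 0 < s) (h0 : 0 < φ)
    (h1 : φ < κ) {z : E2} (hz : z ∉ Dset κ) :
    s * angDist κ φ ≤ 2 * π * dist (polarPt (s, φ)) z := by
  have hpi := Real.pi_pos
  have ha : 0 < angDist κ φ := lt_min h0 (by linarith)
  have ha1 : angDist κ φ ≤ φ := min_le_left _ _
  have ha2 : angDist κ φ ≤ κ - φ := min_le_right _ _
  obtain ⟨t, θ, ht, hθ0, hθ1, rfl⟩ := exists_eq_polarPt z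
  rcases ht.eq_or_lt with rfl | ht'
  · have := abs_sub_le_dist_polarPt hs.le ht φ θ
    rw [sub_zero, abs_of_pos hs] at this
    nlinarith
  have hd : 0 ≤ dist (polarPt (s, φ)) (polarPt (t, θ)) := dist_nonneg
  have hcase : θ = 0 ∨ κ ≤ θ := by
    by_contra! h
    exact hz (mem_Dset_iff.2 ⟨t, θ, ht', lt_of_le_of_ne hθ0 (Ne.symm h.1), h.2, rfl⟩)
  have : s * angDist κ φ ≤ π * dist (polarPt (s, φ)) (polarPt (t, θ)) := by
    rcases hcase with rfl | h
    · have habs : |φ - 0| = φ := by rw [sub_zero, abs_of_pos h0]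
      exact mul_le_pi_mul_dist_polarPt hs.le ht ha.le (by rw [habs]; linarith)
        (by rw [habs]; linarith)
    · have habs : |φ - θ| = θ - φ := by rw [abs_sub_comm, abs_of_pos (by linarith)]
      exact mul_le_pi_mul_dist_polarPt hs.le ht ha.le (by rw [habs]; linarith)
        (by rw [habs]; linarith)
  nlinarith

lemma isOpen_Dset {κ : ℝ} (hκ' : κ < 2 * π) : IsOpen (Dset κ) := by
  rw [Metric.isOpen_iff]
  intro x hx
  obtain ⟨s, φ, hs, h0, h1, rfl⟩ := mem_Dset_iff.1 hx
  have ha : 0 < angDist κ φ := lt_min h0 (by linarith)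
  have hpi := Real.pi_pos
  refine ⟨s * angDist κ φ / (2 * π), by positivity, fun z hz => ?_⟩
  by_contra hzD
  have := mul_angDist_le_of_notMem hκ' hs h0 h1 hzD
  rw [Metric.mem_ball, dist_comm, lt_div_iff₀ (by positivity)] at hz
  linarith

lemma injOn_polarPt {κ : ℝ} (hκ' : κ < 2 * π) :
    InjOn polarPt (Ioi 0 ×ˢ Ioo 0 κ) := by
  rintro ⟨s, φ⟩ ⟨hs, hφ0, hφ1⟩ ⟨t, θ⟩ ⟨ht, hθ0, hθ1⟩ h
  simp only [mem_Ioi] at hs ht hφ0 hφ1 hθ0 hθ1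
  have hst : s = t := by rw [← norm_polarPt hs.le φ, h, norm_polarPt ht.le]
  have hm : |φ - θ| < κ := abs_sub_lt_iff.2 ⟨by linarith, by linarith⟩
  have := mul_le_pi_mul_dist_polarPt (φ := φ) (θ := θ) (m := min |φ - θ| (2 * π - |φ - θ|))
    hs.le ht.le (le_min (abs_nonneg _) (by linarith)) (min_le_left _ _)
    (by linarith [min_le_right |φ - θ| (2 * π - |φ - θ|)])
  rw [h, dist_self, mul_zero] at this
  have h2 : min |φ - θ| (2 * π - |φ - θ|) ≤ 0 := by
    by_contra! hc
    nlinarith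
  have h3 : |φ - θ| ≤ 0 := (min_le_iff.1 h2).resolve_right (by linarith)
  have h4 : φ - θ = 0 := abs_nonpos_iff.1 h3
  exact Prod.ext hst (by simpa using sub_eq_zero.1 h4)

lemma continuous_polarPt : Continuous polarPt := by
  unfold polarPt
  fun_prop

lemma polarPt_mem_frontier {κ s : ℝ} (hκ : 0 < κ) (hκ' : κ < 2 * π) (hs : 0 < s)
    {θ : ℝ} (hθ : θ = 0 ∨ θ = κ) : polarPt (s, θ) ∈ frontier (Dset κ) := by
  have hmem : θ ∈ Icc 0 κ := by
    rcases hθ with rfl | rfl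
    · exact ⟨le_rfl, hκ.le⟩
    · exact ⟨hκ.le, le_rfl⟩
  refine ⟨?_, ?_⟩
  · have hc : Continuous fun φ : ℝ => polarPt (s, φ) := continuous_polarPt.comp (by fun_prop)
    have hmaps : MapsTo (fun φ : ℝ => polarPt (s, φ)) (Ioo 0 κ) (Dset κ) :=
      fun φ hφ => mem_Dset_iff.2 ⟨s, φ, hs, hφ.1, hφ.2, rfl⟩
    exact hmaps.closure hc (by rwa [closure_Ioo hκ.ne])
  · intro h
    obtain ⟨t, φ, ht, h0, h1, he⟩ := mem_Dset_iff.1 (interior_subset h)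
    have hm : 0 < min φ (min (κ - φ) (2 * π - κ)) :=
      lt_min h0 (lt_min (by linarith) (by linarith))
    have hm1 : min φ (min (κ - φ) (2 * π - κ)) ≤ φ := min_le_left _ _
    have hm2 : min φ (min (κ - φ) (2 * π - κ)) ≤ κ - φ :=
      (min_le_right _ _).trans (min_le_left _ _)
    have hm3 : min φ (min (κ - φ) (2 * π - κ)) ≤ 2 * π - κ :=
      (min_le_right _ _).trans (min_le_right _ _)
    have habs : min φ (min (κ - φ) (2 * π - κ)) ≤ |θ - φ| ∧ |θ - φ| ≤ κ := by
      rcases hθ with rfl | rfl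
      · rw [zero_sub, abs_neg, abs_of_pos h0]
        exact ⟨hm1, h1.le⟩
      · rw [abs_of_pos (by linarith)]
        exact ⟨hm2, by linarith⟩
    have := mul_le_pi_mul_dist_polarPt (φ := θ) (θ := φ) hs.le ht.le hm.le habs.1 (by linarith)
    rw [he, dist_self, mul_zero] at this
    nlinarith

lemma rhoD_polarPt_le {κ s φ : ℝ} (hκ : 0 < κ) (hκ' : κ < 2 * π) (hs : 0 < s) (h0 : 0 < φ)
    (h1 : φ < κ) : rhoD κ (polarPt (s, φ)) ≤ s * angDist κ φ := by
  have key : ∀ θ, θ = 0 ∨ θ = κ → rhoD κ (polarPt (s, φ)) ≤ s * |φ - θ| := fun θ hθ => by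
    refine (Metric.infDist_le_dist_of_mem (polarPt_mem_frontier hκ hκ' hs hθ)).trans ?_
    simpa using dist_polarPt_le (s := s) hs.le φ θ
  have k0 := key 0 (Or.inl rfl)
  have k1 := key κ (Or.inr rfl)
  rw [sub_zero, abs_of_pos h0] at k0
  rw [abs_sub_comm, abs_of_pos (by linarith)] at k1
  rcases min_choice φ (κ - φ) with h | h <;> rw [angDist, h] <;> assumption

lemma le_rhoD_polarPt {κ s φ : ℝ} (hκ : 0 < κ) (hκ' : κ < 2 * π) (hs : 0 < s) (h0 : 0 < φ)
    (h1 : φ < κ) : s * angDist κ φ / (2 * π) ≤ rhoD κ (polarPt (s, φ)) := by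
  have hne : (frontier (Dset κ)).Nonempty :=
    ⟨_, polarPt_mem_frontier hκ hκ' hs (Or.inl rfl)⟩
  refine (Metric.le_infDist hne).2 fun z hz => ?_
  rw [(isOpen_Dset hκ').frontier_eq] at hz
  rw [div_le_iff₀' (by positivity)]
  exact mul_angDist_le_of_notMem hκ' hs h0 h1 hz.2

lemma dS1_normalize_polarPt {s t : ℝ} (hs : 0 < s) (ht : 0 < t) (φ θ : ℝ) :
    dS1 (‖polarPt (s, φ)‖⁻¹ • polarPt (s, φ)) (‖polarPt (t, θ)‖⁻¹ • polarPt (t, θ))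
      = Real.arccos (Real.cos (φ - θ)) := by
  rw [dS1, norm_polarPt hs.le, norm_polarPt ht.le, smul_polarPt, smul_polarPt, inner_polarPt,
    inv_mul_cancel₀ hs.ne', inv_mul_cancel₀ ht.ne', one_mul, one_mul]

lemma arccos_cos_eq_abs {a : ℝ} (h : |a| ≤ π) : Real.arccos (Real.cos a) = |a| := by
  rw [← Real.cos_abs, Real.arccos_cos (abs_nonneg _) h]

lemma arccos_cos_eq_two_pi_sub_abs {a : ℝ} (h : π ≤ |a|) (h' : |a| ≤ 2 * π) :
    Real.arccos (Real.cos a) = 2 * π - |a| := by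
  rw [← Real.cos_abs, ← Real.cos_two_pi_sub, Real.arccos_cos (by linarith) (by linarith)]

/-- The polar rectangle of radius `r` around the point with polar coordinates `(s₀, φ₀)`. -/
def polarRect (κ s₀ φ₀ r : ℝ) : Set (ℝ × ℝ) :=
  {s | 0 < s ∧ |s - s₀| < r} ×ˢ {φ | φ ∈ Ioo 0 κ ∧ s₀ * |φ - φ₀| < r}

section Inclusions

variable {κ s₀ φ₀ r : ℝ}

lemma image_polarRect_subset_Sset (hs₀ : 0 ≤ s₀) :
    polarPt '' polarRect κ s₀ φ₀ r ⊆ Sset κ (polarPt (s₀, φ₀)) r := by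
  rintro _ ⟨⟨s, φ⟩, ⟨⟨hs, hsr⟩, ⟨h0, h1⟩, hφ⟩, rfl⟩
  simp only at hs hsr h0 h1 hφ
  refine ⟨mem_Dset_iff.2 ⟨s, φ, hs, h0, h1, rfl⟩, ?_, fun hne => ?_⟩
  · rwa [norm_polarPt hs.le, norm_polarPt hs₀]
  · have hs₀' : 0 < s₀ := by
      rw [← norm_polarPt hs₀ φ₀]
      exact norm_pos_iff.2 hne
    rw [dS1_normalize_polarPt hs₀' hs, norm_polarPt hs₀, lt_div_iff₀' hs₀']
    refine lt_of_le_of_lt (mul_le_mul_of_nonneg_left ?_ hs₀) hφ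
    rw [abs_sub_comm φ]
    rcases le_total |φ₀ - φ| π with h | h
    · exact (arccos_cos_eq_abs h).le
    · exact (Real.arccos_le_pi _).trans h

lemma Sset_subset_image_polarRect {N : ℝ} (hκ' : κ < 2 * π) (hN : 1 ≤ N)
    (hNκ : κ ≤ N * (2 * π - κ)) (hs₀ : 0 ≤ s₀) (h0 : 0 ≤ φ₀) (h1 : φ₀ ≤ κ) (hr : 0 < r) :
    Sset κ (polarPt (s₀, φ₀)) r ⊆ polarPt '' polarRect κ s₀ φ₀ (N * r) := by
  rintro y ⟨hy, hyr, hya⟩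
  obtain ⟨s, φ, hs, hφ0, hφ1, rfl⟩ := mem_Dset_iff.1 hy
  rw [norm_polarPt hs.le, norm_polarPt hs₀] at hyr
  refine ⟨(s, φ), ⟨⟨hs, by nlinarith⟩, ⟨hφ0, hφ1⟩, ?_⟩, rfl⟩
  simp only
  rcases hs₀.eq_or_lt with rfl | hs₀'
  · rw [zero_mul]; positivity
  have hne : polarPt (s₀, φ₀) ≠ 0 := by
    rw [← norm_pos_iff, norm_polarPt hs₀]; exact hs₀'
  have ha := hya hne
  rw [dS1_normalize_polarPt hs₀' hs, norm_polarPt hs₀, lt_div_iff₀' hs₀'] at ha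
  have hlt : |φ₀ - φ| ≤ κ := abs_sub_le_iff.2 ⟨by linarith, by linarith⟩
  rw [abs_sub_comm φ]
  rcases le_total |φ₀ - φ| π with h | h
  · rw [arccos_cos_eq_abs h] at ha
    nlinarith
  · rw [arccos_cos_eq_two_pi_sub_abs h (by linarith)] at ha
    calc s₀ * |φ₀ - φ| ≤ s₀ * (N * (2 * π - κ)) := by gcongr; linarith
      _ ≤ N * (s₀ * (2 * π - |φ₀ - φ|)) := by
        rw [mul_left_comm]; gcongr
      _ < N * r := by gcongr

lemma image_polarRect_subset_ballD (hs₀ : 0 ≤ s₀) :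
    polarPt '' polarRect κ s₀ φ₀ (r / 2) ⊆ ballD κ (polarPt (s₀, φ₀)) r := by
  rintro _ ⟨⟨s, φ⟩, ⟨⟨hs, hsr⟩, ⟨h0, h1⟩, hφ⟩, rfl⟩
  simp only at hs hsr h0 h1 hφ
  refine ⟨mem_Dset_iff.2 ⟨s, φ, hs, h0, h1, rfl⟩, ?_⟩
  linarith [dist_polarPt_le (s := s) hs₀ φ φ₀]

lemma ballD_subset_image_polarRect {N : ℝ} (hκ' : κ < 2 * π) (hN : 1 ≤ N)
    (hNκ : κ ≤ N * (2 * π - κ)) (hs₀ : 0 ≤ s₀) (h0 : 0 ≤ φ₀) (h1 : φ₀ ≤ κ) (hr : 0 < r) :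
    ballD κ (polarPt (s₀, φ₀)) r ⊆ polarPt '' polarRect κ s₀ φ₀ (4 * N * r) := by
  rintro y ⟨hy, hyr⟩
  obtain ⟨s, φ, hs, hφ0, hφ1, rfl⟩ := mem_Dset_iff.1 hy
  have hd := abs_sub_le_dist_polarPt hs.le hs₀ φ φ₀
  refine ⟨(s, φ), ⟨⟨hs, by nlinarith⟩, ⟨hφ0, hφ1⟩, ?_⟩, rfl⟩
  simp only
  rw [dist_comm] at hyr
  rw [abs_sub_comm φ]
  have hlt : |φ₀ - φ| ≤ κ := abs_sub_le_iff.2 ⟨by linarith, by linarith⟩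
  have hpi : π * dist (polarPt (s₀, φ₀)) (polarPt (s, φ)) < 4 * r := by
    have : (0 : ℝ) ≤ dist (polarPt (s₀, φ₀)) (polarPt (s, φ)) := dist_nonneg
    nlinarith [Real.pi_lt_four, Real.pi_pos]
  rcases le_total |φ₀ - φ| π with h | h
  · have := mul_le_pi_mul_dist_polarPt (φ := φ₀) (θ := φ) hs₀ hs.le (abs_nonneg _) le_rfl
      (by linarith)
    nlinarith
  · have := mul_le_pi_mul_dist_polarPt (φ := φ₀) (θ := φ) (m := 2 * π - κ) hs₀ hs.le (by linarith)
      (by linarith) (by linarith)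
    calc s₀ * |φ₀ - φ| ≤ s₀ * (N * (2 * π - κ)) := by gcongr; linarith
      _ = N * (s₀ * (2 * π - κ)) := by ring
      _ < N * (4 * r) := mul_lt_mul_of_pos_left (by linarith) (by linarith)
      _ = 4 * N * r := by ring

end Inclusions

lemma rpow_le_of_comparable {a K s u : ℝ} (hK : 1 ≤ K) (hs : 0 < s) (hu : 0 < u)
    (h1 : s ≤ K * u) (h2 : u ≤ K * s) : s ^ a ≤ K ^ |a| * u ^ a := by
  have hK0 : 0 < K := by linarith
  rcases le_total 0 a with ha | ha
  · rw [abs_of_nonneg ha, ← Real.mul_rpow hK0.le hu.le]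
    exact Real.rpow_le_rpow hs.le h1 ha
  · rw [abs_of_nonpos ha]
    have h : (K * s) ^ a ≤ u ^ a := Real.rpow_le_rpow_of_nonpos hu h2 ha
    rw [Real.mul_rpow hK0.le hs.le] at h
    calc s ^ a = K ^ (-a) * (K ^ a * s ^ a) := by
          rw [← mul_assoc, ← Real.rpow_add hK0]; simp
      _ ≤ K ^ (-a) * u ^ a := by gcongr

/-- The mass given by the power weight `s ^ a` to the interval `(s₀ - r, s₀ + r) ∩ (0, ∞)`. -/
def powMass (a s₀ r : ℝ) : ℝ≥0∞ :=
  ∫⁻ s in {s : ℝ | 0 < s ∧ |s - s₀| < r}, ENNReal.ofReal (s ^ a)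

lemma measurableSet_powMass (s₀ r : ℝ) : MeasurableSet {s : ℝ | 0 < s ∧ |s - s₀| < r} :=
  (measurableSet_lt measurable_const measurable_id).inter
    (measurableSet_lt (f := fun s : ℝ => |s - s₀|) (by fun_prop) measurable_const)

lemma le_powMass (a : ℝ) {s₀ r : ℝ} (hs₀ : 0 ≤ s₀) (hr : 0 < r) :
    ENNReal.ofReal ((2 ^ |a|)⁻¹ / 2 * (r * (s₀ + r) ^ a)) ≤ powMass a s₀ r := by
  have hsub : Ioo (s₀ + r / 2) (s₀ + r) ⊆ {s : ℝ | 0 < s ∧ |s - s₀| < r} := fun s hs =>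
    ⟨by linarith [hs.1], abs_lt.2 ⟨by linarith [hs.1], by linarith [hs.2]⟩⟩
  have h2 : (0 : ℝ) < 2 ^ |a| := by positivity
  calc ENNReal.ofReal ((2 ^ |a|)⁻¹ / 2 * (r * (s₀ + r) ^ a))
      = ∫⁻ _ in Ioo (s₀ + r / 2) (s₀ + r), ENNReal.ofReal ((2 ^ |a|)⁻¹ * (s₀ + r) ^ a) := by
        rw [setLIntegral_const, Real.volume_Ioo, ← ENNReal.ofReal_mul (by positivity)]
        congr 1; ring
    _ ≤ ∫⁻ s in Ioo (s₀ + r / 2) (s₀ + r), ENNReal.ofReal (s ^ a) := by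
        refine setLIntegral_mono' measurableSet_Ioo fun s hs => ENNReal.ofReal_le_ofReal ?_
        rw [inv_mul_le_iff₀ h2]
        exact rpow_le_of_comparable one_le_two (by linarith) (by linarith [hs.1])
          (by linarith [hs.1]) (by linarith [hs.1, hs.2])
    _ ≤ powMass a s₀ r := lintegral_mono_set hsub

lemma lintegral_rpow_Ioo {a R : ℝ} (ha : -1 < a) (hR : 0 < R) :
    ∫⁻ s in Ioo 0 R, ENNReal.ofReal (s ^ a) = ENNReal.ofReal (R ^ (a + 1) / (a + 1)) := by
  have hint : IntegrableOn (fun s : ℝ => s ^ a) (Ioc 0 R) :=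
    (intervalIntegrable_iff_integrableOn_Ioc_of_le hR.le).1
      (intervalIntegral.intervalIntegrable_rpow' ha)
  rw [setLIntegral_congr Ioo_ae_eq_Ioc, ← ofReal_integral_eq_lintegral_ofReal hint,
    ← intervalIntegral.integral_of_le hR.le, integral_rpow (Or.inl ha),
    Real.zero_rpow (by linarith), sub_zero]
  filter_upwards [ae_restrict_mem measurableSet_Ioc] with s hs
  exact Real.rpow_nonneg hs.1.le a

lemma powMass_le {a N : ℝ} (ha : -1 < a) (hN : 1 ≤ N) :
    ∃ C : ℝ, 0 < C ∧ ∀ s₀ r : ℝ, 0 ≤ s₀ → 0 < r →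
      powMass a s₀ (N * r) ≤ ENNReal.ofReal (C * (r * (s₀ + r) ^ a)) := by
  have hN0 : 0 < N := by linarith
  have ha1 : 0 < a + 1 := by linarith
  refine ⟨(3 * N) ^ (a + 1) / (a + 1) * (2 * N + 1) ^ |a| + 2 * N * 4 ^ |a|, by positivity,
    fun s₀ r hs₀ hr => ?_⟩
  have hsr : 0 < s₀ + r := by linarith
  have hp : 0 < (s₀ + r) ^ a := by positivity
  rcases le_total s₀ (2 * N * r) with h | h
  · have hNr : r ≤ N * r := by nlinarith
    calc powMass a s₀ (N * r) ≤ ∫⁻ s in Ioo 0 (3 * N * r), ENNReal.ofReal (s ^ a) := by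
          refine lintegral_mono_set fun s hs => ⟨hs.1, ?_⟩
          linarith [(abs_lt.1 hs.2).2]
      _ = ENNReal.ofReal ((3 * N * r) ^ (a + 1) / (a + 1)) :=
          lintegral_rpow_Ioo ha (by positivity)
      _ ≤ _ := by
          apply ENNReal.ofReal_le_ofReal
          have hra : r ^ a ≤ (2 * N + 1) ^ |a| * (s₀ + r) ^ a :=
            rpow_le_of_comparable (by linarith) hr hsr (by nlinarith) (by nlinarith)
          calc (3 * N * r) ^ (a + 1) / (a + 1)
              = (3 * N) ^ (a + 1) / (a + 1) * (r * r ^ a) := by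
                rw [Real.mul_rpow (by positivity) hr.le, Real.rpow_add_one hr.ne']; ring
            _ ≤ (3 * N) ^ (a + 1) / (a + 1) * (r * ((2 * N + 1) ^ |a| * (s₀ + r) ^ a)) := by
                gcongr
            _ ≤ _ := by
                have : 0 ≤ 2 * N * 4 ^ |a| * (r * (s₀ + r) ^ a) := by positivity
                linarith
  · have hNr : r ≤ N * r := by nlinarith
    calc powMass a s₀ (N * r)
        ≤ ∫⁻ _ in {s : ℝ | 0 < s ∧ |s - s₀| < N * r}, ENNReal.ofReal (4 ^ |a| * (s₀ + r) ^ a) := by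
          refine setLIntegral_mono' (measurableSet_powMass _ _) fun s hs =>
            ENNReal.ofReal_le_ofReal ?_
          obtain ⟨h3, h4⟩ := abs_lt.1 hs.2
          exact rpow_le_of_comparable (by norm_num) hs.1 hsr (by linarith) (by linarith)
      _ ≤ ∫⁻ _ in Ioo (s₀ - N * r) (s₀ + N * r), ENNReal.ofReal (4 ^ |a| * (s₀ + r) ^ a) := by
          refine lintegral_mono_set fun s hs => ?_
          obtain ⟨h3, h4⟩ := abs_lt.1 hs.2
          exact ⟨by linarith, by linarith⟩
      _ = ENNReal.ofReal (2 * N * 4 ^ |a| * (r * (s₀ + r) ^ a)) := by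
          rw [setLIntegral_const, Real.volume_Ioo, ← ENNReal.ofReal_mul (by positivity)]
          congr 1; ring
      _ ≤ _ := by
          apply ENNReal.ofReal_le_ofReal
          have : 0 ≤ (3 * N) ^ (a + 1) / (a + 1) * (2 * N + 1) ^ |a| * (r * (s₀ + r) ^ a) := by
            positivity
          linarith

lemma powMass_doubling {a N : ℝ} (ha : -1 < a) (hN : 1 ≤ N) :
    ∃ C : ℝ, 0 < C ∧ ∀ s₀ r : ℝ, 0 ≤ s₀ → 0 < r →
      powMass a s₀ (N * r) ≤ ENNReal.ofReal C * powMass a s₀ r := by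
  obtain ⟨C, hC, h⟩ := powMass_le ha hN
  refine ⟨C * (2 * 2 ^ |a|), by positivity, fun s₀ r hs₀ hr => (h s₀ r hs₀ hr).trans ?_⟩
  refine le_trans (le_of_eq ?_) (mul_le_mul_right (le_powMass a hs₀ hr) _)
  rw [← ENNReal.ofReal_mul (by positivity)]
  congr 1
  have : (0 : ℝ) < 2 ^ |a| := by positivity
  field_simp

/-- The mass given by the weight `angDist κ ^ γ` to the interval `(φ₀ - t, φ₀ + t) ∩ (0, κ)`. -/
def angMass (κ γ φ₀ t : ℝ) : ℝ≥0∞ :=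
  ∫⁻ φ in {φ : ℝ | φ ∈ Ioo 0 κ ∧ |φ - φ₀| < t}, ENNReal.ofReal (angDist κ φ ^ γ)

lemma measurableSet_angMass (κ φ₀ t : ℝ) :
    MeasurableSet {φ : ℝ | φ ∈ Ioo 0 κ ∧ |φ - φ₀| < t} :=
  measurableSet_Ioo.inter
    (measurableSet_lt (f := fun φ : ℝ => |φ - φ₀|) (by fun_prop) measurable_const)

lemma angMass_mono (κ γ φ₀ : ℝ) {t t' : ℝ} (h : t ≤ t') :
    angMass κ γ φ₀ t ≤ angMass κ γ φ₀ t' :=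
  lintegral_mono_set fun _ hφ => ⟨hφ.1, hφ.2.trans_le h⟩

lemma angDist_symm (κ φ : ℝ) : angDist κ (κ - φ) = angDist κ φ := by
  rw [angDist, angDist, sub_sub_cancel, min_comm]

lemma lintegral_reflect (κ : ℝ) (f : ℝ → ℝ≥0∞) (s : Set ℝ) :
    ∫⁻ φ in (fun φ => κ - φ) ⁻¹' s, f (κ - φ) = ∫⁻ φ in s, f φ :=
  (Measure.measurePreserving_sub_left volume κ).setLIntegral_comp_preimage_emb
    (MeasurableEquiv.subLeft κ).measurableEmbedding f s

lemma angMass_symm (κ γ φ₀ t : ℝ) : angMass κ γ (κ - φ₀) t = angMass κ γ φ₀ t := by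
  rw [angMass, angMass, ← lintegral_reflect κ]
  simp only [angDist_symm]
  congr 2
  ext φ
  simp only [mem_preimage, mem_ofPred_eq, mem_Ioo, sub_pos, sub_lt_self_iff]
  rw [show κ - φ - (κ - φ₀) = -(φ - φ₀) by ring, abs_neg]
  tauto

lemma angMass_le_powMass {κ γ φ₀ t : ℝ} (h : φ₀ + t ≤ 3 / 4 * κ) :
    angMass κ γ φ₀ t ≤ ENNReal.ofReal (3 ^ |γ|) * powMass γ φ₀ t := by
  rw [powMass, ← lintegral_const_mul' _ _ ENNReal.ofReal_ne_top]
  refine (setLIntegral_mono' (measurableSet_angMass _ _ _) fun φ hφ => ?_).trans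
    (lintegral_mono_set fun φ hφ => ⟨hφ.1.1, hφ.2⟩)
  rw [← ENNReal.ofReal_mul (by positivity)]
  obtain ⟨⟨h0, h1⟩, h2⟩ := hφ
  have h3 := (abs_lt.1 h2).2
  have hd : angDist κ φ ≤ φ := min_le_left _ _
  have hd' : φ / 3 ≤ angDist κ φ := le_min (by linarith) (by linarith)
  exact ENNReal.ofReal_le_ofReal <| rpow_le_of_comparable (by norm_num) (by linarith) h0
    (by linarith) (by linarith)

lemma powMass_le_angMass {κ γ φ₀ t : ℝ} (hκ : 0 < κ) (h : φ₀ + t ≤ 3 / 4 * κ) :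
    powMass γ φ₀ t ≤ ENNReal.ofReal (3 ^ |γ|) * angMass κ γ φ₀ t := by
  rw [angMass, ← lintegral_const_mul' _ _ ENNReal.ofReal_ne_top]
  have hlt : ∀ φ, |φ - φ₀| < t → φ < 3 / 4 * κ := fun φ hφ => by linarith [(abs_lt.1 hφ).2]
  refine (setLIntegral_mono' (measurableSet_powMass _ _) fun φ hφ => ?_).trans
    (lintegral_mono_set fun φ hφ => ⟨⟨hφ.1, by linarith [hlt φ hφ.2]⟩, hφ.2⟩)
  rw [← ENNReal.ofReal_mul (by positivity)]
  obtain ⟨h0, h2⟩ := hφ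
  have h3 := hlt φ h2
  have hd : angDist κ φ ≤ φ := min_le_left _ _
  have hd' : φ / 3 ≤ angDist κ φ := le_min (by linarith) (by linarith)
  exact ENNReal.ofReal_le_ofReal <| rpow_le_of_comparable (by norm_num) h0 (by linarith)
    (by linarith) (by linarith)

lemma angMass_le_total (κ γ φ₀ t : ℝ) :
    angMass κ γ φ₀ t ≤ 2 * ∫⁻ φ in Ioo 0 κ, ENNReal.ofReal (φ ^ γ) := by
  have hrefl : ∫⁻ φ in Ioo 0 κ, ENNReal.ofReal ((κ - φ) ^ γ)
      = ∫⁻ φ in Ioo 0 κ, ENNReal.ofReal (φ ^ γ) := by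
    rw [← lintegral_reflect κ (fun φ => ENNReal.ofReal (φ ^ γ))]
    congr 2
    ext φ
    simp only [mem_preimage, mem_Ioo, sub_pos, sub_lt_self_iff]
    tauto
  calc angMass κ γ φ₀ t ≤ ∫⁻ φ in Ioo 0 κ, ENNReal.ofReal (angDist κ φ ^ γ) :=
        lintegral_mono_set fun φ hφ => hφ.1
    _ ≤ ∫⁻ φ in Ioo 0 κ, (ENNReal.ofReal (φ ^ γ) + ENNReal.ofReal ((κ - φ) ^ γ)) := by
        refine lintegral_mono fun φ => ?_
        rcases min_choice φ (κ - φ) with h | h <;> rw [angDist, h]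
        · exact le_self_add
        · exact le_add_self
    _ = 2 * ∫⁻ φ in Ioo 0 κ, ENNReal.ofReal (φ ^ γ) := by
        rw [lintegral_add_left (by fun_prop), hrefl, two_mul]

lemma angMass_doubling {κ γ N : ℝ} (hκ : 0 < κ) (hγ : -1 < γ) (hN : 1 ≤ N) :
    ∃ C : ℝ, 0 < C ∧ ∀ φ₀ t : ℝ, 0 ≤ φ₀ → φ₀ ≤ κ → 0 < t →
      angMass κ γ φ₀ (N * t) ≤ ENNReal.ofReal C * angMass κ γ φ₀ t := by
  have hN0 : 0 < N := by linarith
  obtain ⟨C, hC, hCpow⟩ := powMass_doubling hγ hN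
  obtain ⟨C', hC', hCpow'⟩ := powMass_doubling hγ (N := 4 * N) (by linarith)
  have h3 : (0 : ℝ) < 3 ^ |γ| := by positivity
  refine ⟨max (3 ^ |γ| * C * 3 ^ |γ|) (2 * C' * 3 ^ |γ|), by positivity, ?_⟩
  have half : ∀ φ₀ t : ℝ, 0 ≤ φ₀ → φ₀ ≤ κ / 2 → 0 < t → angMass κ γ φ₀ (N * t) ≤
      ENNReal.ofReal (max (3 ^ |γ| * C * 3 ^ |γ|) (2 * C' * 3 ^ |γ|)) * angMass κ γ φ₀ t := by
    intro φ₀ t h0 h1 ht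
    rcases le_total (N * t) (κ / 4) with h | h
    · calc angMass κ γ φ₀ (N * t)
          ≤ ENNReal.ofReal (3 ^ |γ|) * powMass γ φ₀ (N * t) := angMass_le_powMass (by linarith)
        _ ≤ ENNReal.ofReal (3 ^ |γ|) * (ENNReal.ofReal C *
              (ENNReal.ofReal (3 ^ |γ|) * angMass κ γ φ₀ t)) := by
            gcongr
            refine (hCpow φ₀ t h0 ht).trans ?_
            gcongr
            exact powMass_le_angMass hκ (by nlinarith)
        _ = ENNReal.ofReal (3 ^ |γ| * C * 3 ^ |γ|) * angMass κ γ φ₀ t := by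
            rw [ENNReal.ofReal_mul (by positivity), ENNReal.ofReal_mul (by positivity)]
            ring
        _ ≤ _ := by gcongr; exact le_max_left _ _
    · set t' := κ / (4 * N) with ht'
      have ht'0 : 0 < t' := by positivity
      have hNt' : 4 * N * t' = κ := by rw [ht']; field_simp
      have ht't : t' ≤ t := by nlinarith
      have ht'κ : t' ≤ κ / 4 := by nlinarith
      calc angMass κ γ φ₀ (N * t)
          ≤ 2 * ∫⁻ φ in Ioo 0 κ, ENNReal.ofReal (φ ^ γ) := angMass_le_total _ _ _ _
        _ ≤ 2 * powMass γ φ₀ (4 * N * t') := by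
            gcongr
            refine lintegral_mono_set fun φ hφ => ⟨hφ.1, ?_⟩
            rw [hNt']
            exact abs_lt.2 ⟨by linarith [hφ.1], by linarith [hφ.2]⟩
        _ ≤ 2 * (ENNReal.ofReal C' * (ENNReal.ofReal (3 ^ |γ|) * angMass κ γ φ₀ t)) := by
            gcongr
            refine (hCpow' φ₀ t' h0 ht'0).trans ?_
            gcongr
            refine (powMass_le_angMass hκ (by linarith)).trans ?_
            gcongr
            exact angMass_mono _ _ _ ht't
        _ = ENNReal.ofReal (2 * C' * 3 ^ |γ|) * angMass κ γ φ₀ t := by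
            rw [ENNReal.ofReal_mul (by positivity), ENNReal.ofReal_mul (by positivity),
              ENNReal.ofReal_ofNat]
            ring
        _ ≤ _ := by gcongr; exact le_max_right _ _
  intro φ₀ t h0 h1 ht
  rcases le_total φ₀ (κ / 2) with h | h
  · exact half φ₀ t h0 h ht
  · have := half (κ - φ₀) t (by linarith) (by linarith) ht
    rwa [angMass_symm, angMass_symm] at this

lemma lintegral_image_polarPt {κ : ℝ} (hκ' : κ < 2 * π) {Q : Set (ℝ × ℝ)} (hQ : MeasurableSet Q)
    (hQsub : Q ⊆ Ioi 0 ×ˢ Ioo 0 κ) (f : E2 → ℝ≥0∞) :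
    ∫⁻ x in polarPt '' Q, f x = ∫⁻ p in Q, ENNReal.ofReal p.1 * f (polarPt p) := by
  let e : ℝ × ℝ ≃ᵐ E2 := MeasurableEquiv.finTwoArrow.symm.trans (MeasurableEquiv.toLp 2 _)
  have he : MeasurePreserving e :=
    (volume_preserving_finTwoArrow ℝ).symm.trans (PiLp.volume_preserving_toLp (Fin 2))
  have hcomp : ∀ p, e (polarCoord.symm p) = polarPt p := fun p => by
    ext i
    fin_cases i <;> rfl
  have himg : polarPt '' Q = e '' (polarCoord.symm '' Q) := by
    rw [image_image]
    exact image_congr fun p _ => (hcomp p).symm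
  have hinj : InjOn polarCoord.symm Q := fun p hp q hq h =>
    injOn_polarPt hκ' (hQsub hp) (hQsub hq) (by rw [← hcomp, ← hcomp, h])
  rw [himg, ← he.setLIntegral_comp_emb e.measurableEmbedding,
    lintegral_image_eq_lintegral_abs_det_fderiv_mul volume hQ
      (fun p _ => (hasFDerivAt_polarCoord_symm p).hasFDerivWithinAt) hinj]
  refine setLIntegral_congr_fun hQ fun p hp => ?_
  simp only [hcomp, det_fderivPolarCoordSymm, abs_of_pos (show 0 < p.1 from (hQsub hp).1)]

lemma mul_wgt_polarPt_le {κ γ ν s φ : ℝ} (hκ : 0 < κ) (hκ' : κ < 2 * π) (hs : 0 < s)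
    (h0 : 0 < φ) (h1 : φ < κ) :
    s * wgt κ γ ν (polarPt (s, φ)) ≤ (2 * π) ^ |γ| * (s ^ (ν + 1) * angDist κ φ ^ γ) ∧
    s ^ (ν + 1) * angDist κ φ ^ γ ≤ (2 * π) ^ |γ| * (s * wgt κ γ ν (polarPt (s, φ))) := by
  have ha : 0 < angDist κ φ := lt_min h0 (by linarith)
  have hpi : 1 ≤ 2 * π := by linarith [Real.pi_gt_three]
  have hle := rhoD_polarPt_le hκ hκ' hs h0 h1
  have hge := le_rhoD_polarPt hκ hκ' hs h0 h1
  have hsa : 0 < s * angDist κ φ := by positivity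
  have hρ : 0 < rhoD κ (polarPt (s, φ)) := lt_of_lt_of_le (by positivity) hge
  rw [div_le_iff₀' (by positivity)] at hge
  have heq : s ^ (ν + 1) * angDist κ φ ^ γ = s * s ^ (ν - γ) * (s * angDist κ φ) ^ γ := by
    rw [Real.mul_rpow hs.le ha.le, Real.rpow_add_one hs.ne', show ν = ν - γ + γ by ring,
      Real.rpow_add hs]
    ring_nf
  rw [wgt, norm_polarPt hs.le, heq]
  have hss : 0 < s * s ^ (ν - γ) := by positivity
  constructor
  · calc s * (s ^ (ν - γ) * rhoD κ (polarPt (s, φ)) ^ γ)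
        = s * s ^ (ν - γ) * rhoD κ (polarPt (s, φ)) ^ γ := by ring
      _ ≤ s * s ^ (ν - γ) * ((2 * π) ^ |γ| * (s * angDist κ φ) ^ γ) := by
          gcongr
          exact rpow_le_of_comparable hpi hρ hsa (by nlinarith) hge
      _ = _ := by ring
  · calc s * s ^ (ν - γ) * (s * angDist κ φ) ^ γ
        ≤ s * s ^ (ν - γ) * ((2 * π) ^ |γ| * rhoD κ (polarPt (s, φ)) ^ γ) := by
          gcongr
          exact rpow_le_of_comparable hpi hsa hρ hge (by nlinarith)
      _ = _ := by ring

/-- The angular factor of the mass of a polar rectangle. -/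
def rectAngMass (κ γ s₀ φ₀ r : ℝ) : ℝ≥0∞ :=
  ∫⁻ φ in {φ : ℝ | φ ∈ Ioo 0 κ ∧ s₀ * |φ - φ₀| < r}, ENNReal.ofReal (angDist κ φ ^ γ)

lemma rectAngMass_zero {κ γ φ₀ r r' : ℝ} (hr : 0 < r) (hr' : 0 < r') :
    rectAngMass κ γ 0 φ₀ r = rectAngMass κ γ 0 φ₀ r' := by
  simp [rectAngMass, hr, hr']

lemma rectAngMass_eq {κ γ s₀ φ₀ r : ℝ} (hs₀ : 0 < s₀) :
    rectAngMass κ γ s₀ φ₀ r = angMass κ γ φ₀ (r / s₀) := by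
  simp only [rectAngMass, angMass, lt_div_iff₀' hs₀]

lemma rectAngMass_doubling {κ γ N : ℝ} (hκ : 0 < κ) (hγ : -1 < γ) (hN : 1 ≤ N) :
    ∃ C : ℝ, 0 < C ∧ ∀ s₀ φ₀ r : ℝ, 0 ≤ s₀ → 0 ≤ φ₀ → φ₀ ≤ κ → 0 < r →
      rectAngMass κ γ s₀ φ₀ (N * r) ≤ ENNReal.ofReal C * rectAngMass κ γ s₀ φ₀ r := by
  obtain ⟨C, hC, h⟩ := angMass_doubling hκ hγ hN
  refine ⟨max 1 C, by positivity, fun s₀ φ₀ r hs₀ h0 h1 hr => ?_⟩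
  rcases hs₀.eq_or_lt with rfl | hs₀
  · rw [rectAngMass_zero (r := N * r) (by positivity) hr]
    refine le_mul_of_one_le_left' ?_
    rw [← ENNReal.ofReal_one]
    exact ENNReal.ofReal_le_ofReal (le_max_left _ _)
  · rw [rectAngMass_eq hs₀, rectAngMass_eq hs₀, mul_div_assoc]
    refine (h φ₀ (r / s₀) h0 h1 (by positivity)).trans ?_
    gcongr
    exact le_max_right _ _

lemma measurableSet_polarRect (κ s₀ φ₀ r : ℝ) : MeasurableSet (polarRect κ s₀ φ₀ r) :=
  (measurableSet_powMass _ _).prod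
    (measurableSet_Ioo.inter
      (measurableSet_lt (f := fun φ : ℝ => s₀ * |φ - φ₀|) (by fun_prop) measurable_const))

lemma polarRect_subset (κ s₀ φ₀ r : ℝ) : polarRect κ s₀ φ₀ r ⊆ Ioi 0 ×ˢ Ioo 0 κ :=
  fun _ hp => ⟨hp.1.1, hp.2.1⟩

lemma powMass_mul_rectAngMass (κ γ ν s₀ φ₀ r : ℝ) :
    powMass (ν + 1) s₀ r * rectAngMass κ γ s₀ φ₀ r
      = ∫⁻ p in polarRect κ s₀ φ₀ r,
          ENNReal.ofReal (p.1 ^ (ν + 1)) * ENNReal.ofReal (angDist κ p.2 ^ γ) := by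
  rw [polarRect, Measure.volume_eq_prod, ← Measure.prod_restrict,
    lintegral_prod_mul (f := fun s => ENNReal.ofReal (s ^ (ν + 1)))
      (g := fun φ => ENNReal.ofReal (angDist κ φ ^ γ))]
  · rfl
  · fun_prop
  · unfold angDist; fun_prop

lemma wMeas_polarRect {κ γ ν : ℝ} (hκ : 0 < κ) (hκ' : κ < 2 * π) (s₀ φ₀ r : ℝ) :
    wMeas κ γ ν (polarPt '' polarRect κ s₀ φ₀ r)
      ≤ ENNReal.ofReal ((2 * π) ^ |γ|) * (powMass (ν + 1) s₀ r * rectAngMass κ γ s₀ φ₀ r) ∧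
    powMass (ν + 1) s₀ r * rectAngMass κ γ s₀ φ₀ r
      ≤ ENNReal.ofReal ((2 * π) ^ |γ|) * wMeas κ γ ν (polarPt '' polarRect κ s₀ φ₀ r) := by
  rw [powMass_mul_rectAngMass, wMeas,
    lintegral_image_polarPt hκ' (measurableSet_polarRect _ _ _ _) (polarRect_subset _ _ _ _),
    ← lintegral_const_mul' _ _ ENNReal.ofReal_ne_top,
    ← lintegral_const_mul' _ _ ENNReal.ofReal_ne_top]
  have hpi := Real.pi_pos
  constructor
  all_goals
    refine setLIntegral_mono' (measurableSet_polarRect _ _ _ _) fun p hp => ?_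
    obtain ⟨⟨hs, -⟩, ⟨h0, h1⟩, -⟩ := hp
    rw [← ENNReal.ofReal_mul hs.le, ← ENNReal.ofReal_mul (by positivity),
      ← ENNReal.ofReal_mul (by positivity)]
    apply ENNReal.ofReal_le_ofReal
  · exact (mul_wgt_polarPt_le hκ hκ' hs h0 h1).1
  · exact (mul_wgt_polarPt_le hκ hκ' hs h0 h1).2

lemma wMeas_polarRect_doubling {κ γ ν N : ℝ} (hκ : 0 < κ) (hκ' : κ < 2 * π) (hγ : -1 < γ)
    (hν : -2 < ν) (hN : 1 ≤ N) :
    ∃ C : ℝ, 0 < C ∧ ∀ s₀ φ₀ r : ℝ, 0 ≤ s₀ → 0 ≤ φ₀ → φ₀ ≤ κ → 0 < r →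
      wMeas κ γ ν (polarPt '' polarRect κ s₀ φ₀ (N * r))
        ≤ ENNReal.ofReal C * wMeas κ γ ν (polarPt '' polarRect κ s₀ φ₀ r) := by
  obtain ⟨C₁, hC₁, h₁⟩ := powMass_doubling (a := ν + 1) (by linarith) hN
  obtain ⟨C₂, hC₂, h₂⟩ := rectAngMass_doubling hκ hγ hN
  have hpi := Real.pi_pos
  refine ⟨(2 * π) ^ |γ| * (C₁ * C₂) * (2 * π) ^ |γ|, by positivity,
    fun s₀ φ₀ r hs₀ h0 h1 hr => ?_⟩
  calc wMeas κ γ ν (polarPt '' polarRect κ s₀ φ₀ (N * r))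
      ≤ ENNReal.ofReal ((2 * π) ^ |γ|) *
          (powMass (ν + 1) s₀ (N * r) * rectAngMass κ γ s₀ φ₀ (N * r)) :=
        (wMeas_polarRect hκ hκ' _ _ _).1
    _ ≤ ENNReal.ofReal ((2 * π) ^ |γ|) * ((ENNReal.ofReal C₁ * powMass (ν + 1) s₀ r) *
          (ENNReal.ofReal C₂ * rectAngMass κ γ s₀ φ₀ r)) := by
        gcongr
        · exact h₁ s₀ r hs₀ hr
        · exact h₂ s₀ φ₀ r hs₀ h0 h1 hr
    _ = ENNReal.ofReal ((2 * π) ^ |γ|) * (ENNReal.ofReal C₁ * ENNReal.ofReal C₂) *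
          (powMass (ν + 1) s₀ r * rectAngMass κ γ s₀ φ₀ r) := by ring
    _ ≤ ENNReal.ofReal ((2 * π) ^ |γ|) * (ENNReal.ofReal C₁ * ENNReal.ofReal C₂) *
          (ENNReal.ofReal ((2 * π) ^ |γ|) * wMeas κ γ ν (polarPt '' polarRect κ s₀ φ₀ r)) := by
        exact mul_le_mul_right (wMeas_polarRect hκ hκ' _ _ _).2 _
    _ = _ := by
        rw [ENNReal.ofReal_mul (by positivity), ENNReal.ofReal_mul (by positivity),
          ENNReal.ofReal_mul (by positivity)]
        ring

lemma wMeas_mono (κ γ ν : ℝ) {E F : Set E2} (h : E ⊆ F) : wMeas κ γ ν E ≤ wMeas κ γ ν F :=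
  lintegral_mono_set h

theorem stmt2 (κ : ℝ) (hκ : 0 < κ) (hκ' : κ < 2 * π)
    (γ ν : ℝ) (hγ : -1 < γ) (hν : -2 < ν) :
    ∃ c C : ℝ, 0 < c ∧ c ≤ C ∧ ∀ x ∈ closure (Dset κ), ∀ r : ℝ, 0 < r →
      ENNReal.ofReal c * wMeas κ γ ν (Sset κ x r) ≤ wMeas κ γ ν (ballD κ x r) ∧
      wMeas κ γ ν (ballD κ x r) ≤ ENNReal.ofReal C * wMeas κ γ ν (Sset κ x r) := by
  have hgap : 0 < 2 * π - κ := by linarith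
  obtain ⟨N, hN, hNκ⟩ : ∃ N : ℝ, 1 ≤ N ∧ κ ≤ N * (2 * π - κ) :=
    ⟨max 1 (κ / (2 * π - κ)), le_max_left _ _, by
      rw [← div_le_iff₀ hgap]; exact le_max_right _ _⟩
  obtain ⟨C, hC, hdbl⟩ := wMeas_polarRect_doubling (N := 4 * N) hκ hκ' hγ hν (by linarith)
  refine ⟨(max 1 C)⁻¹, max 1 C, by positivity,
    (inv_le_one_of_one_le₀ (le_max_left _ _)).trans (le_max_left _ _), fun x hx r hr => ?_⟩
  obtain ⟨s₀, φ₀, hs₀, h0, h1, rfl⟩ := exists_of_mem_closure_Dset hx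
  have hCle : ENNReal.ofReal C ≤ ENNReal.ofReal (max 1 C) :=
    ENNReal.ofReal_le_ofReal (le_max_right _ _)
  constructor
  · rw [ENNReal.ofReal_inv_of_pos (by positivity), mul_comm, ← div_eq_mul_inv]
    refine ENNReal.div_le_of_le_mul' ?_
    calc wMeas κ γ ν (Sset κ (polarPt (s₀, φ₀)) r)
        ≤ wMeas κ γ ν (polarPt '' polarRect κ s₀ φ₀ (2 * N * r)) := wMeas_mono _ _ _ <|
          Sset_subset_image_polarRect hκ' (by linarith) (by nlinarith) hs₀ h0 h1 hr
      _ = wMeas κ γ ν (polarPt '' polarRect κ s₀ φ₀ (4 * N * (r / 2))) := by ring_nf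
      _ ≤ ENNReal.ofReal C * wMeas κ γ ν (polarPt '' polarRect κ s₀ φ₀ (r / 2)) :=
          hdbl s₀ φ₀ (r / 2) hs₀ h0 h1 (by positivity)
      _ ≤ _ := mul_le_mul' hCle (wMeas_mono _ _ _ (image_polarRect_subset_ballD hs₀))
  · calc wMeas κ γ ν (ballD κ (polarPt (s₀, φ₀)) r)
        ≤ wMeas κ γ ν (polarPt '' polarRect κ s₀ φ₀ (4 * N * r)) := wMeas_mono _ _ _ <|
          ballD_subset_image_polarRect hκ' hN hNκ hs₀ h0 h1 hr
      _ ≤ ENNReal.ofReal C * wMeas κ γ ν (polarPt '' polarRect κ s₀ φ₀ r) :=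
          hdbl s₀ φ₀ r hs₀ h0 h1 hr
      _ ≤ _ := mul_le_mul' hCle (wMeas_mono _ _ _ (image_polarRect_subset_Sset hs₀))
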